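/- arXiv:1908.11082 — 2 statements merged into one kernel-verified Lean document; each statement's English description precedes it below -/
import Mathlib

section
/- Mixed ℓ₂/ℓ_q error bound for the group lasso with block k-sparse signals: let q > 1 be real, k ≥ 1, x block k-sparse, κ ∈ (0,1), μ > 0, ε with ‖Aᵀε‖_{2,∞} ≤ κμ, and y = A x + ε. Let x̂ be a global minimizer of the group lasso objective z ↦ (1/2)‖y − A z‖₂² + μ‖z‖_{2,1}. Suppose β > 0 is such that ‖A z‖₂ ≥ β·‖z‖_{2,q} for every z with ‖z‖_{2,1} ≤ (2/(1−κ))·k^{1-1/q}·‖z‖_{2,q} (i.e. β is a lower bound for β_{q,(2/(1−κ))^{q/(q-1)}k}(A)). Then ‖x̂ − x‖_{2,q} ≤ ((1+κ)/(1−κ))·2·k^{1-1/q}·μ/β². -/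
open scoped BigOperators

noncomputable section

/-- Mixed ℓ₂/ℓ₁ norm of a block signal: sum of the Euclidean norms of the blocks. -/
def mnorm1 {p n : ℕ} (x : Fin p → EuclideanSpace ℝ (Fin n)) : ℝ := ∑ i, ‖x i‖

/-- Mixed ℓ₂/ℓ_q norm of a block signal. -/
def mnorm {p n : ℕ} (q : ℝ) (x : Fin p → EuclideanSpace ℝ (Fin n)) : ℝ :=
  (∑ i, ‖x i‖ ^ q) ^ (1 / q)

/-- Mixed ℓ₂/ℓ_∞ norm of a block signal: the largest block norm. -/
def mnormInf {p n : ℕ} (x : Fin p → EuclideanSpace ℝ (Fin n)) : ℝ := ⨆ i, ‖x i‖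

/-- Hölder's inequality between the mixed ℓ₂/ℓ₁ and ℓ₂/ℓ_q norms on a set of at most `k` blocks. -/
theorem sum_norm_le_rpow_mul_mnorm {p n : ℕ} {q : ℝ} (hq : 1 < q) {k : ℕ} {S : Finset (Fin p)}
    (hS : S.card ≤ k) (h : Fin p → EuclideanSpace ℝ (Fin n)) :
    ∑ i ∈ S, ‖h i‖ ≤ (k : ℝ) ^ (1 - 1 / q) * mnorm q h := by
  have hc := Real.HolderConjugate.conjExponent hq
  have key := Real.inner_le_Lp_mul_Lq S (fun _ => (1 : ℝ)) (fun i => ‖h i‖) hc.symm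
  have he : 1 / Real.conjExponent q = 1 - 1 / q := by
    have := hc.inv_add_inv_eq_one
    rw [one_div, one_div]
    linarith
  simp only [one_mul, abs_one, Real.one_rpow, Finset.sum_const, nsmul_eq_mul, mul_one,
    abs_norm, he] at key
  refine key.trans ?_
  have hq' : 1 / q ≤ 1 := by
    rw [div_le_one (by linarith)]
    exact hq.le
  unfold mnorm
  gcongr
  exact Finset.subset_univ S

/-- Duality between the mixed ℓ₂/ℓ₁ and ℓ₂/ℓ_∞ norms. -/
theorem abs_inner_le_mnormInf_mul_mnorm1 {p n : ℕ}
    (u v : PiLp 2 (fun _ : Fin p => EuclideanSpace ℝ (Fin n))) :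
    |inner ℝ u v| ≤ mnormInf u * mnorm1 v := by
  rw [PiLp.inner_apply, mnorm1, Finset.mul_sum]
  refine (Finset.abs_sum_le_sum_abs _ _).trans (Finset.sum_le_sum fun i _ => ?_)
  refine (abs_real_inner_le_norm _ _).trans ?_
  gcongr
  exact le_ciSup (f := fun j => ‖u j‖) (Set.finite_range _).bddAbove i

/-- The variational inequality satisfied by a minimizer of the group lasso objective. -/
theorem inner_residual_le_of_groupLasso_min {p n m : ℕ}
    (A : PiLp 2 (fun _ : Fin p => EuclideanSpace ℝ (Fin n)) →L[ℝ] EuclideanSpace ℝ (Fin m))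
    {μ : ℝ} (hμ : 0 < μ) (y : EuclideanSpace ℝ (Fin m))
    (xh : PiLp 2 (fun _ : Fin p => EuclideanSpace ℝ (Fin n)))
    (hmin : ∀ z : PiLp 2 (fun _ : Fin p => EuclideanSpace ℝ (Fin n)),
      (1 / 2) * ‖y - A xh‖ ^ 2 + μ * mnorm1 xh ≤ (1 / 2) * ‖y - A z‖ ^ 2 + μ * mnorm1 z)
    (x : PiLp 2 (fun _ : Fin p => EuclideanSpace ℝ (Fin n))) :
    inner ℝ (y - A xh) (A (x - xh)) ≤ μ * (mnorm1 x - mnorm1 xh) := by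
  set d := inner ℝ (y - A xh) (A (x - xh)) - μ * (mnorm1 x - mnorm1 xh) with hd
  set b := ‖A (x - xh)‖ ^ 2 with hb
  have hb0 : 0 ≤ b := by positivity
  have hlin : ∀ t : ℝ, 0 < t → t ≤ 1 → d ≤ t * b := by
    intro t ht ht1
    have h1 := hmin (xh + t • (x - xh))
    have h2 : mnorm1 (xh + t • (x - xh)) ≤ (1 - t) * mnorm1 xh + t * mnorm1 x := by
      unfold mnorm1
      rw [Finset.mul_sum, Finset.mul_sum, ← Finset.sum_add_distrib]
      refine Finset.sum_le_sum fun i _ => ?_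
      have he : xh i + t • (x i - xh i) = (1 - t) • xh i + t • x i := by module
      simp only [PiLp.add_apply, PiLp.smul_apply, PiLp.sub_apply]
      rw [he]
      refine (norm_add_le _ _).trans_eq ?_
      rw [norm_smul, norm_smul, Real.norm_of_nonneg ht.le, Real.norm_of_nonneg (by linarith)]
    have h3 : ‖y - A (xh + t • (x - xh))‖ ^ 2 =
        ‖y - A xh‖ ^ 2 - 2 * t * inner ℝ (y - A xh) (A (x - xh)) + t ^ 2 * b := by
      rw [map_add, map_smul, ← sub_sub, norm_sub_sq_real, inner_smul_right, norm_smul, mul_pow,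
        Real.norm_eq_abs, sq_abs]
      ring
    have h4 := mul_le_mul_of_nonneg_left h2 hμ.le
    have h5 : t * d ≤ t * (t * b) := by
      rw [h3] at h1
      nlinarith [mul_nonneg (sq_nonneg t) hb0]
    exact le_of_mul_le_mul_left h5 ht
  suffices d ≤ 0 by linarith
  by_contra! hpos
  have h1 := hlin 1 one_pos le_rfl
  have hbpos : 0 < b := by linarith
  have h2 := hlin (d / (2 * b)) (by positivity) (by rw [div_le_one (by positivity)]; linarith)
  have h3 : d / (2 * b) * b = d / 2 := by field_simp
  linarith

/-- The ℓ₂/ℓ₁ decrease from `x` to `xh` is at most the mass of `xh - x` on the support of `x` minus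
its mass off the support. -/
theorem mnorm1_sub_mnorm1_le {p n : ℕ} (S : Finset (Fin p))
    (x xh : Fin p → EuclideanSpace ℝ (Fin n)) (hx : ∀ i ∉ S, x i = 0) :
    mnorm1 x - mnorm1 xh ≤ 2 * ∑ i ∈ S, ‖xh i - x i‖ - ∑ i, ‖xh i - x i‖ := by
  unfold mnorm1
  rw [← Finset.sum_add_sum_compl S fun i => ‖x i‖, ← Finset.sum_add_sum_compl S fun i => ‖xh i‖,
    ← Finset.sum_add_sum_compl S fun i => ‖xh i - x i‖]
  have h1 : ∑ i ∈ S, ‖x i‖ ≤ ∑ i ∈ S, ‖xh i‖ + ∑ i ∈ S, ‖xh i - x i‖ := by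
    rw [← Finset.sum_add_distrib]
    exact Finset.sum_le_sum fun i _ => norm_le_norm_add_norm_sub _ _
  have h2 : ∑ i ∈ Sᶜ, ‖x i‖ = 0 :=
    Finset.sum_eq_zero fun i hi => by rw [hx i (Finset.mem_compl.mp hi), norm_zero]
  have h3 : ∑ i ∈ Sᶜ, ‖xh i - x i‖ = ∑ i ∈ Sᶜ, ‖xh i‖ :=
    Finset.sum_congr rfl fun i hi => by rw [hx i (Finset.mem_compl.mp hi), sub_zero]
  linarith

/-- Mixed ℓ₂/ℓ_q error bound for the group lasso with block k-sparse signals. -/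
theorem stmt_9 {p n m : ℕ}
    (A : PiLp 2 (fun _ : Fin p => EuclideanSpace ℝ (Fin n)) →L[ℝ] EuclideanSpace ℝ (Fin m))
    (q : ℝ) (hq : 1 < q) (k : ℕ) (hk : 1 ≤ k)
    (x : PiLp 2 (fun _ : Fin p => EuclideanSpace ℝ (Fin n)))
    (hx : ∃ S : Finset (Fin p), S.card ≤ k ∧ ∀ i ∉ S, x i = 0)
    (κ : ℝ) (hκ0 : 0 < κ) (hκ1 : κ < 1)
    (μ : ℝ) (hμ : 0 < μ)
    (ε : EuclideanSpace ℝ (Fin m))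
    (hε : mnormInf (ContinuousLinearMap.adjoint A ε) ≤ κ * μ)
    (y : EuclideanSpace ℝ (Fin m)) (hy : y = A x + ε)
    (xh : PiLp 2 (fun _ : Fin p => EuclideanSpace ℝ (Fin n)))
    (hmin : ∀ z : PiLp 2 (fun _ : Fin p => EuclideanSpace ℝ (Fin n)),
      (1 / 2) * ‖y - A xh‖ ^ 2 + μ * mnorm1 xh ≤ (1 / 2) * ‖y - A z‖ ^ 2 + μ * mnorm1 z)
    (β : ℝ) (hβ : 0 < β)
    (hcmsv : ∀ z : PiLp 2 (fun _ : Fin p => EuclideanSpace ℝ (Fin n)),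
      mnorm1 z ≤ (2 / (1 - κ)) * (k : ℝ) ^ (1 - 1 / q) * mnorm q z → β * mnorm q z ≤ ‖A z‖) :
    mnorm q (xh - x) ≤ ((1 + κ) / (1 - κ)) * 2 * (k : ℝ) ^ (1 - 1 / q) * μ / β ^ 2 := by
  obtain ⟨S, hS, hxS⟩ := hx
  have hcone := mnorm1_sub_mnorm1_le S x xh hxS
  have hvar := inner_residual_le_of_groupLasso_min A hμ y xh hmin x
  have hhol := sum_norm_le_rpow_mul_mnorm hq hS (xh - x)
  have hdual := abs_inner_le_mnormInf_mul_mnorm1 (ContinuousLinearMap.adjoint A ε) (xh - x)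
  rw [ContinuousLinearMap.adjoint_inner_left] at hdual
  have hstar := hcmsv (xh - x)
  have hM : mnorm1 (xh - x) = ∑ i, ‖xh i - x i‖ := rfl
  change ∑ i ∈ S, ‖xh i - x i‖ ≤ (k : ℝ) ^ (1 - 1 / q) * mnorm q (xh - x) at hhol
  have hres : inner ℝ (y - A xh) (A (x - xh)) =
      ‖A (xh - x)‖ ^ 2 - inner ℝ ε (A (xh - x)) := by
    have h1 : y - A xh = ε - A (xh - x) := by rw [hy, map_sub]; abel
    have h2 : A (x - xh) = -A (xh - x) := by rw [← map_neg, neg_sub]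
    rw [h1, h2, inner_neg_right, inner_sub_left, real_inner_self_eq_norm_sq]
    ring
  rw [hres] at hvar
  change _ ≤ _ * mnorm1 (xh - x) at hdual
  have hN0 : 0 ≤ mnorm q (xh - x) := by unfold mnorm; positivity
  have hM0 : 0 ≤ mnorm1 (xh - x) := by unfold mnorm1; positivity
  have htri : mnorm1 x - mnorm1 xh ≤ mnorm1 (xh - x) := by
    unfold mnorm1
    rw [← Finset.sum_sub_distrib]
    exact Finset.sum_le_sum fun i _ =>
      (norm_sub_norm_le _ _).trans_eq (norm_sub_rev _ _)
  rw [← hM] at hcone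
  set M := mnorm1 (xh - x)
  set N := mnorm q (xh - x)
  set C := (k : ℝ) ^ (1 - 1 / q)
  set s := ∑ i ∈ S, ‖xh i - x i‖
  have hcorr : inner ℝ ε (A (xh - x)) ≤ κ * μ * M :=
    (le_abs_self _).trans (hdual.trans (mul_le_mul_of_nonneg_right hε hM0))
  have hκ : 0 < 1 - κ := by linarith
  have hM : M ≤ 2 / (1 - κ) * C * N := by
    have h1 : μ * ((1 - κ) * M) ≤ μ * (2 * s) := by
      have := mul_le_mul_of_nonneg_left hcone hμ.le
      nlinarith [sq_nonneg ‖A (xh - x)‖]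
    have h2 := le_of_mul_le_mul_left h1 hμ
    rw [show 2 / (1 - κ) * C * N = 2 * (C * N) / (1 - κ) by ring, le_div_iff₀ hκ]
    linarith
  have hA : ‖A (xh - x)‖ ^ 2 ≤ (1 + κ) * μ * (2 / (1 - κ) * C * N) := by
    have h1 := mul_le_mul_of_nonneg_left htri hμ.le
    have h2 := mul_le_mul_of_nonneg_left hM (show 0 ≤ (1 + κ) * μ by positivity)
    linarith
  have hsq : (β * N) ^ 2 ≤ ‖A (xh - x)‖ ^ 2 :=
    pow_le_pow_left₀ (by positivity) (hstar hM) 2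
  have hC : 0 ≤ C := by positivity
  rcases hN0.eq_or_lt with h0 | hpos
  · rw [← h0]
    positivity
  · rw [le_div_iff₀ (by positivity)]
    refine le_of_mul_le_mul_right ?_ hpos
    calc N * β ^ 2 * N = (β * N) ^ 2 := by ring
      _ ≤ (1 + κ) * μ * (2 / (1 - κ) * C * N) := hsq.trans hA
      _ = (1 + κ) / (1 - κ) * 2 * C * μ * N := by ring
end
end

section
/- Mixed ℓ₂/ℓ_q error bound for the group lasso with block compressible signals: let q > 1 be real, k ≥ 1, and let x be any block signal. Let S be a set of k block indices containing k largest blocks of x (i.e. ‖x_i‖₂ ≥ ‖x_j‖₂ whenever i ∈ S and j ∉ S), and set φ = ∑_{i∉S} ‖x_i‖₂ (the best block k-term approximation error φ_k(x)). Let κ ∈ (0,1), μ > 0, ε with ‖Aᵀε‖_{2,∞} ≤ κμ, y = A x + ε, and let x̂ be a global minimizer of z ↦ (1/2)‖y − A z‖₂² + μ‖z‖_{2,1}. Suppose β > 0 is such that ‖A z‖₂ ≥ β·‖z‖_{2,q} for every z with ‖z‖_{2,1} ≤ (4/(1−κ))·k^{1-1/q}·‖z‖_{2,q}. Then ‖x̂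 − x‖_{2,q} ≤ ((1+κ)/(1−κ))·4·k^{1-1/q}·μ/β² + k^{1/q-1}·φ. -/
open scoped BigOperators

noncomputable section

/-- Hölder's inequality for a partial sum of block norms. -/
theorem sum_norm_le_card_rpow_mul_mnorm {p n : ℕ} {q : ℝ} (hq : 1 < q)
    (z : Fin p → EuclideanSpace ℝ (Fin n)) (S : Finset (Fin p)) :
    ∑ i ∈ S, ‖z i‖ ≤ (S.card : ℝ) ^ (1 - 1 / q) * mnorm q z := by
  have hc : q.HolderConjugate (q.conjExponent) := Real.HolderConjugate.conjExponent hq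
  have h := Real.inner_le_Lp_mul_Lq_of_nonneg S (f := fun _ => (1 : ℝ)) (g := fun i => ‖z i‖)
    hc.symm (fun _ _ => zero_le_one) (fun _ _ => norm_nonneg _)
  have he : 1 / q.conjExponent = 1 - 1 / q := by
    rw [one_div, one_div, ← hc.inv_add_inv_eq_one]; ring
  simp only [one_mul, Real.one_rpow, Finset.sum_const, nsmul_eq_mul, mul_one, he] at h
  refine h.trans (mul_le_mul_of_nonneg_left ?_ (by positivity))
  unfold mnorm
  refine Real.rpow_le_rpow (Finset.sum_nonneg fun _ _ => by positivity) ?_ (by positivity)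
  exact Finset.sum_le_sum_of_subset_of_nonneg (Finset.subset_univ _) fun _ _ _ => by positivity

/-- Duality of the mixed `ℓ₂/ℓ_∞` and `ℓ₂/ℓ₁` norms. -/
theorem inner_le_mnormInf_mul_mnorm1 {p n : ℕ}
    (u v : PiLp 2 (fun _ : Fin p => EuclideanSpace ℝ (Fin n))) :
    inner ℝ u v ≤ mnormInf u * mnorm1 v := by
  rw [PiLp.inner_apply, mnorm1, Finset.mul_sum]
  refine Finset.sum_le_sum fun i _ => (real_inner_le_norm _ _).trans ?_
  exact mul_le_mul_of_nonneg_right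
    (le_ciSup (f := fun i => ‖u i‖) (Set.finite_range _).bddAbove i) (norm_nonneg _)

/-- Perturbing a block signal `x` by `h` decreases its `ℓ₂/ℓ₁` norm by at most the part of `h` on
`S`, up to the part of `x` off `S`. -/
theorem mnorm1_add_mnorm1_le {p n : ℕ} (x h : Fin p → EuclideanSpace ℝ (Fin n))
    (S : Finset (Fin p)) :
    mnorm1 x + mnorm1 h ≤ mnorm1 (x + h) + 2 * ∑ i ∈ S, ‖h i‖ + 2 * ∑ i ∈ Sᶜ, ‖x i‖ := by
  unfold mnorm1
  rw [← Finset.sum_add_sum_compl S (fun i => ‖x i‖), ← Finset.sum_add_sum_compl S (fun i => ‖h i‖),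
    ← Finset.sum_add_sum_compl S (fun i => ‖(x + h) i‖)]
  have h₁ : ∑ i ∈ S, ‖x i‖ ≤ ∑ i ∈ S, ‖(x + h) i‖ + ∑ i ∈ S, ‖h i‖ := by
    rw [← Finset.sum_add_distrib]
    exact Finset.sum_le_sum fun i _ => by simpa using norm_sub_le (x i + h i) (h i)
  have h₂ : ∑ i ∈ Sᶜ, ‖h i‖ ≤ ∑ i ∈ Sᶜ, ‖(x + h) i‖ + ∑ i ∈ Sᶜ, ‖x i‖ := by
    rw [← Finset.sum_add_distrib]
    exact Finset.sum_le_sum fun i _ => by simpa using norm_sub_le (x i + h i) (x i)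
  linarith

theorem mnorm1_sub_smul_le {p n : ℕ} (x h : Fin p → EuclideanSpace ℝ (Fin n)) {t : ℝ}
    (ht : 0 ≤ t) : mnorm1 (x - t • h) ≤ mnorm1 x + t * mnorm1 h := by
  unfold mnorm1
  rw [Finset.mul_sum, ← Finset.sum_add_distrib]
  refine Finset.sum_le_sum fun i _ => (norm_sub_le _ _).trans ?_
  simp [norm_smul, abs_of_nonneg ht]

theorem nonneg_of_forall_pos_nonneg_add_mul {a b : ℝ} (h : ∀ t : ℝ, 0 < t → 0 ≤ a + t * b) :
    0 ≤ a := by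
  refine ge_of_tendsto (x := nhdsWithin 0 (Set.Ioi 0)) (f := fun t : ℝ => a + t * b) ?_
    (by filter_upwards [self_mem_nhdsWithin] with t ht using h t ht)
  have hc : Continuous fun t : ℝ => a + t * b := by fun_prop
  simpa using (hc.tendsto 0).mono_left nhdsWithin_le_nhds

/-- First-order optimality of a group lasso minimizer `z`, tested in the direction `-h`. -/
theorem neg_inner_le_of_groupLasso_minimizer {p n m : ℕ}
    (A : PiLp 2 (fun _ : Fin p => EuclideanSpace ℝ (Fin n)) →L[ℝ] EuclideanSpace ℝ (Fin m))
    {μ : ℝ} (hμ : 0 ≤ μ) (y : EuclideanSpace ℝ (Fin m))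
    (z h : PiLp 2 (fun _ : Fin p => EuclideanSpace ℝ (Fin n)))
    (hmin : ∀ w : PiLp 2 (fun _ : Fin p => EuclideanSpace ℝ (Fin n)),
      (1 / 2) * ‖y - A z‖ ^ 2 + μ * mnorm1 z ≤ (1 / 2) * ‖y - A w‖ ^ 2 + μ * mnorm1 w) :
    -inner ℝ (y - A z) (A h) ≤ μ * mnorm1 h := by
  suffices 0 ≤ inner ℝ (y - A z) (A h) + μ * mnorm1 h by linarith
  refine nonneg_of_forall_pos_nonneg_add_mul (b := ‖A h‖ ^ 2 / 2) fun t ht => ?_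
  have h₁ := hmin (z - t • h)
  have h₂ : y - A (z - t • h) = (y - A z) + t • A h := by
    rw [map_sub, map_smul]; abel
  rw [h₂, norm_add_sq_real, inner_smul_right, norm_smul, Real.norm_of_nonneg ht.le] at h₁
  have h₃ := mul_le_mul_of_nonneg_left (mnorm1_sub_smul_le z h ht.le) hμ
  rw [← WithLp.ofLp_smul, ← WithLp.ofLp_sub] at h₃
  refine nonneg_of_mul_nonneg_right (a := t) ?_ ht
  linarith

/-- Mixed ℓ₂/ℓ_q error bound for the group lasso with block compressible signals. -/
theorem stmt_14 {p n m : ℕ}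
    (A : PiLp 2 (fun _ : Fin p => EuclideanSpace ℝ (Fin n)) →L[ℝ] EuclideanSpace ℝ (Fin m))
    (q : ℝ) (hq : 1 < q) (k : ℕ) (hk : 1 ≤ k)
    (x : PiLp 2 (fun _ : Fin p => EuclideanSpace ℝ (Fin n)))
    (S : Finset (Fin p)) (hScard : S.card = k)
    (hSlargest : ∀ i ∈ S, ∀ j ∉ S, ‖x j‖ ≤ ‖x i‖)
    (φ : ℝ) (hφ : φ = ∑ i ∈ Sᶜ, ‖x i‖)
    (κ : ℝ) (hκ0 : 0 < κ) (hκ1 : κ < 1)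
    (μ : ℝ) (hμ : 0 < μ)
    (ε : EuclideanSpace ℝ (Fin m))
    (hε : mnormInf (ContinuousLinearMap.adjoint A ε) ≤ κ * μ)
    (y : EuclideanSpace ℝ (Fin m)) (hy : y = A x + ε)
    (xh : PiLp 2 (fun _ : Fin p => EuclideanSpace ℝ (Fin n)))
    (hmin : ∀ z : PiLp 2 (fun _ : Fin p => EuclideanSpace ℝ (Fin n)),
      (1 / 2) * ‖y - A xh‖ ^ 2 + μ * mnorm1 xh ≤ (1 / 2) * ‖y - A z‖ ^ 2 + μ * mnorm1 z)
    (β : ℝ) (hβ : 0 < β)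
    (hcmsv : ∀ z : PiLp 2 (fun _ : Fin p => EuclideanSpace ℝ (Fin n)),
      mnorm1 z ≤ (4 / (1 - κ)) * (k : ℝ) ^ (1 - 1 / q) * mnorm q z → β * mnorm q z ≤ ‖A z‖) :
    mnorm q (xh - x) ≤
      ((1 + κ) / (1 - κ)) * 4 * (k : ℝ) ^ (1 - 1 / q) * μ / β ^ 2 + (k : ℝ) ^ (1 / q - 1) * φ := by
  have hk0 : (0 : ℝ) < k := by exact_mod_cast hk
  have hκ : 0 < 1 - κ := by linarith
  set K : ℝ := (k : ℝ) ^ (1 - 1 / q) with hK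
  have hK0 : 0 < K := Real.rpow_pos_of_pos hk0 _
  have hKinv : (k : ℝ) ^ (1 / q - 1) = K⁻¹ := by
    rw [hK, ← Real.rpow_neg hk0.le, neg_sub]
  have hφ0 : 0 ≤ φ := hφ ▸ Finset.sum_nonneg fun _ _ => norm_nonneg _
  obtain ⟨h, rfl⟩ : ∃ h, xh = x + h := ⟨xh - x, by abel⟩
  rw [add_sub_cancel_left, hKinv]
  have hN0 : 0 ≤ mnorm q h :=
    Real.rpow_nonneg (Finset.sum_nonneg fun _ _ => Real.rpow_nonneg (norm_nonneg _) _) _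
  have hh0 : 0 ≤ mnorm1 h := Finset.sum_nonneg fun _ _ => norm_nonneg _
  have hres : y - A (x + h) = ε - A h := by
    rw [hy, map_add]; abel
  have hnoise : inner ℝ ε (A h) ≤ κ * μ * mnorm1 h := by
    rw [← ContinuousLinearMap.adjoint_inner_left]
    exact (inner_le_mnormInf_mul_mnorm1 _ _).trans (mul_le_mul_of_nonneg_right hε hh0)
  by_cases hcone : mnorm1 h ≤ (4 / (1 - κ)) * K * mnorm q h
  · have hlower := hcmsv h hcone
    have hopt := neg_inner_le_of_groupLasso_minimizer A hμ.le y (x + h) h hmin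
    rw [hres, inner_sub_left, real_inner_self_eq_norm_sq] at hopt
    have hupper : (β * mnorm q h) ^ 2 ≤ (1 + κ) * μ * ((4 / (1 - κ)) * K * mnorm q h) :=
      calc (β * mnorm q h) ^ 2 ≤ ‖A h‖ ^ 2 := by gcongr
        _ ≤ (1 + κ) * μ * mnorm1 h := by linarith
        _ ≤ _ := by gcongr
    have hfirst : mnorm q h ≤ ((1 + κ) / (1 - κ)) * 4 * K * μ / β ^ 2 := by
      rcases hN0.eq_or_lt with h0 | hpos
      · rw [← h0]; positivity
      · rw [le_div_iff₀ (by positivity)]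
        refine le_of_mul_le_mul_right ?_ hpos
        calc mnorm q h * β ^ 2 * mnorm q h = (β * mnorm q h) ^ 2 := by ring
          _ ≤ _ := hupper
          _ = _ := by ring
    have : 0 ≤ K⁻¹ * φ := by positivity
    linarith
  · have hx := hmin x
    rw [hres, hy, add_sub_cancel_left, norm_sub_sq_real] at hx
    have hsplit := mnorm1_add_mnorm1_le x h S
    rw [← hφ, show x.ofLp + h.ofLp = (x + h).ofLp from rfl] at hsplit
    have hS := sum_norm_le_card_rpow_mul_mnorm hq h S
    rw [hScard, ← hK] at hS
    have hdec : mnorm1 (x + h) ≤ mnorm1 x + κ * mnorm1 h := by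
      refine le_of_mul_le_mul_left ?_ hμ
      linarith [sq_nonneg ‖A h‖]
    have hlarge : 4 * (K * mnorm q h) < (1 - κ) * mnorm1 h := by
      have := mul_lt_mul_of_pos_left (not_le.mp hcone) hκ
      have he : (1 - κ) * (4 / (1 - κ) * K * mnorm q h) = 4 * (K * mnorm q h) := by
        field_simp
      linarith
    have hsecond : mnorm q h ≤ K⁻¹ * φ := by
      rw [le_inv_mul_iff₀ hK0]
      linarith
    have : 0 ≤ ((1 + κ) / (1 - κ)) * 4 * K * μ / β ^ 2 := by positivity
    linarith
end
end
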